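/- For every f ∈ Λ̄, E(D_k²(f)) = (Σ_{a,b≥1} p_{a+b−2} ∂_a ∂_b − k Σ_{a,b≥0} p_a p_b ∂_{a+b+2} + (1+k) Σ_{a≥2} (a−1) p_{a−2} ∂_a)(f), where ∂_a = a·∂/∂p_a; i.e., the second rational CMS integral at infinity L^{(2)} coincides with the rational CMS operator at infinity. -/

import Mathlib

open Polynomial MvPolynomial

noncomputable section

/-- Λ̄ = ℂ[p₀,p₁,…] -/
abbrev Lam : Type := MvPolynomial ℕ ℂ
/-- Λ̄[x] -/
abbrev LamX : Type := Polynomial Lam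

/-- the derivation on coefficients: p_l ↦ l·x^{l-1} -/
def coeffDer : Derivation ℂ Lam LamX :=
  MvPolynomial.mkDerivation ℂ (fun l => (l : LamX) * Polynomial.X ^ (l - 1))

/-- ∂ : the ℂ-derivation of Λ̄[x] with ∂x = 1, ∂p_l = l x^{l-1}. -/
def pd (f : LamX) : LamX :=
  Polynomial.derivative f + f.sum (fun i c => coeffDer c * Polynomial.X ^ i)

/-- Δ(x^l). -/
def Dvals (l : ℕ) : LamX :=
  if l = 0 then 0 else
    (∑ j ∈ Finset.range l, Polynomial.X ^ (l - 1 - j) * Polynomial.C (MvPolynomial.X j))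
      - (l : LamX) * Polynomial.X ^ (l - 1)

/-- Δ : Λ̄-linear, Δ(x^l f) = Δ(x^l)·f. -/
def Del (f : LamX) : LamX := f.sum (fun l c => Polynomial.C c * Dvals l)

/-- Dunkl operator at infinity, D_k = ∂ − kΔ. -/
def Dk (k : ℂ) (f : LamX) : LamX := pd f - k • Del f

/-- E : Λ̄[x] → Λ̄, x^l f ↦ p_l f. -/
def E (f : LamX) : Lam := f.sum (fun l c => c * MvPolynomial.X l)

/-- L^{(r)} = E ∘ D_k^r restricted to Λ̄. -/
def Lr (k : ℂ) (r : ℕ) (f : Lam) : Lam := E ((Dk k)^[r] (Polynomial.C f))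

end

theorem E_add (f g : LamX) : E (f + g) = E f + E g :=
  Polynomial.sum_add_index f g _ (fun _ => zero_mul _) fun _ _ _ => add_mul _ _ _

theorem E_C_mul_X_pow (c : Lam) (n : ℕ) :
    E (Polynomial.C c * Polynomial.X ^ n) = c * MvPolynomial.X n := by
  rw [E, Polynomial.C_mul_X_pow_eq_monomial, Polynomial.sum_monomial_index _ _ (by simp)]

theorem E_C_mul (c : Lam) (f : LamX) : E (Polynomial.C c * f) = c * E f := by
  induction f using Polynomial.induction_on' with
  | add p q hp hq => rw [mul_add, E_add, E_add, hp, hq, mul_add]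
  | monomial n a =>
    rw [← Polynomial.C_mul_X_pow_eq_monomial, ← mul_assoc, ← map_mul, E_C_mul_X_pow,
      E_C_mul_X_pow, mul_assoc]

/-- `E` as a `Λ̄`-linear map. -/
noncomputable def linearE : LamX →ₗ[Lam] Lam where
  toFun := E
  map_add' := E_add
  map_smul' c f := by rw [Polynomial.smul_eq_C_mul, E_C_mul, RingHom.id_apply, smul_eq_mul]

theorem E_sum {ι : Type*} (s : Finset ι) (f : ι → LamX) : E (∑ i ∈ s, f i) = ∑ i ∈ s, E (f i) :=
  map_sum linearE f s

theorem E_sub (f g : LamX) : E (f - g) = E f - E g :=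
  map_sub linearE f g

theorem E_smul (k : ℂ) (f : LamX) : E (k • f) = k • E f :=
  LinearMap.map_smul_of_tower linearE k f

theorem pd_add (f g : LamX) : pd (f + g) = pd f + pd g := by
  rw [pd, pd, pd, Polynomial.derivative_add,
    Polynomial.sum_add_index f g _ (fun _ => by simp) fun _ _ _ => by simp [add_mul]]
  abel

theorem pd_C_mul_X_pow (c : Lam) (n : ℕ) :
    pd (Polynomial.C c * Polynomial.X ^ n) =
      Polynomial.C (c * n) * Polynomial.X ^ (n - 1) + coeffDer c * Polynomial.X ^ n := by
  rw [pd, Polynomial.derivative_C_mul_X_pow, Polynomial.C_mul_X_pow_eq_monomial (n := n),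
    Polynomial.sum_monomial_index _ _ (by simp)]

theorem Del_add (f g : LamX) : Del (f + g) = Del f + Del g :=
  Polynomial.sum_add_index f g _ (fun _ => by simp) fun _ _ _ => by simp [add_mul]

theorem Del_C_mul_X_pow (c : Lam) (n : ℕ) :
    Del (Polynomial.C c * Polynomial.X ^ n) = Polynomial.C c * Dvals n := by
  rw [Del, Polynomial.C_mul_X_pow_eq_monomial, Polynomial.sum_monomial_index _ _ (by simp)]

theorem Dk_add (k : ℂ) (f g : LamX) : Dk k (f + g) = Dk k f + Dk k g := by
  rw [Dk, Dk, Dk, pd_add, Del_add, smul_add]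
  abel

theorem Dk_sum (k : ℂ) {ι : Type*} (s : Finset ι) (f : ι → LamX) :
    Dk k (∑ i ∈ s, f i) = ∑ i ∈ s, Dk k (f i) :=
  map_sum (AddMonoidHom.mk' (Dk k) (Dk_add k)) f s

theorem Dk_C (k : ℂ) (c : Lam) : Dk k (Polynomial.C c) = coeffDer c := by
  have h1 := pd_C_mul_X_pow c 0
  have h2 := Del_C_mul_X_pow c 0
  rw [pow_zero, mul_one] at h1 h2
  simp [Dk, h1, h2, Dvals]

/-- Expansion of `coeffDer` in terms of partial derivatives. -/
theorem coeffDer_eq_sum {c : Lam} {N : ℕ} (h : ∀ i ∈ c.vars, i < N + 1) :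
    coeffDer c = ∑ l ∈ Finset.range N,
      Polynomial.C (((l + 1 : ℕ) : Lam) * pderiv (l + 1) c) * Polynomial.X ^ l := by
  let D : Derivation ℂ Lam LamX := ∑ l ∈ Finset.range N,
    (LinearMap.toSpanSingleton Lam LamX (((l + 1 : ℕ) : LamX) * Polynomial.X ^ l)).compDer
      (pderiv (l + 1))
  have hD (g : Lam) : D g = ∑ l ∈ Finset.range N,
      Polynomial.C (((l + 1 : ℕ) : Lam) * pderiv (l + 1) g) * Polynomial.X ^ l := by
    refine (congrFun (map_sum (Derivation.coeFnAddMonoidHom (R := ℂ) (A := Lam) (M := LamX)) _ _) g).trans ?_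
    rw [Finset.sum_apply]
    refine Finset.sum_congr rfl fun l _ => ?_
    change pderiv (l + 1) g • (((l + 1 : ℕ) : LamX) * Polynomial.X ^ l) = _
    rw [Polynomial.smul_eq_C_mul, map_mul, Polynomial.C_eq_natCast]
    ring
  rw [← hD]
  refine derivation_eq_of_forall_mem_vars fun i hi => ?_
  rw [hD, coeffDer, MvPolynomial.mkDerivation_X]
  rcases i with _ | i
  · simp [pderiv_X]
  · rw [Finset.sum_eq_single i]
    · simp
    · intro b _ hb
      rw [pderiv_X_of_ne (by omega)]
      simp
    · intro hb
      exact absurd (h _ hi) (by simpa using hb)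

theorem E_coeffDer_mul_X_pow {c : Lam} {N : ℕ} (h : ∀ i ∈ c.vars, i < N + 1) (n : ℕ) :
    E (coeffDer c * Polynomial.X ^ n) = ∑ l ∈ Finset.range N,
      ((l + 1 : ℕ) : Lam) * pderiv (l + 1) c * MvPolynomial.X (l + n) := by
  simp only [coeffDer_eq_sum h, Finset.sum_mul, mul_assoc _ (Polynomial.X ^ _), ← pow_add, E_sum,
    E_C_mul_X_pow]

theorem E_Dvals_zero : E (Dvals 0) = 0 := by
  rw [Dvals, if_pos rfl]
  exact map_zero linearE

theorem E_Dvals_succ (n : ℕ) :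
    E (Dvals (n + 1)) = ∑ j ∈ Finset.range (n + 1),
      MvPolynomial.X j * MvPolynomial.X (n - j) - ((n + 1 : ℕ) : Lam) * MvPolynomial.X n := by
  rw [Dvals, if_neg n.succ_ne_zero, E_sub, E_sum, Nat.add_sub_cancel, ← Polynomial.C_eq_natCast,
    E_C_mul_X_pow]
  simp only [mul_comm _ (Polynomial.C _), E_C_mul_X_pow]

theorem E_Dk_C_mul_X_pow (k : ℂ) (c : Lam) (n : ℕ) :
    E (Dk k (Polynomial.C c * Polynomial.X ^ n)) =
      c * (n : Lam) * MvPolynomial.X (n - 1) + E (coeffDer c * Polynomial.X ^ n)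
        - k • (c * E (Dvals n)) := by
  rw [Dk, E_sub, E_smul, pd_C_mul_X_pow, Del_C_mul_X_pow, E_add, E_C_mul_X_pow, E_C_mul]

theorem exists_forall_vars_pderiv_lt (f : Lam) :
    ∃ N, (∀ i ∈ f.vars, i < N) ∧ ∀ l, ∀ i ∈ (pderiv l f).vars, i < N := by
  classical
  obtain ⟨N, hN⟩ := (f.vars ∪ f.vars.biUnion fun l => (pderiv l f).vars).bddAbove
  refine ⟨N + 1, fun i hi => ?_, fun l i hi => ?_⟩
  · exact Nat.lt_succ_of_le (hN (by simp [hi]))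
  · have hl : l ∈ f.vars := by
      by_contra hl
      simp [pderiv_eq_zero_of_notMem_vars hl] at hi
    refine Nat.lt_succ_of_le (hN ?_)
    rw [Finset.mem_coe, Finset.mem_union, Finset.mem_biUnion]
    exact Or.inr ⟨l, hl, hi⟩

theorem finsum_eq_sum_range {M : Type*} [AddCommMonoid M] {f : ℕ → M} {N : ℕ}
    (h : ∀ i, N ≤ i → f i = 0) : ∑ᶠ i, f i = ∑ i ∈ Finset.range N, f i := by
  refine finsum_eq_sum_of_support_subset f fun i hi => ?_
  by_contra hn
  exact hi (h i (by simpa using hn))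

/-- the second rational CMS integral at infinity coincides with the
rational CMS operator at infinity:
L^{(2)} = Σ_{a,b≥1} p_{a+b−2} ∂_a∂_b − k Σ_{a,b≥0} p_a p_b ∂_{a+b+2}
          + (1+k) Σ_{a≥2} (a−1) p_{a−2} ∂_a,  with ∂_a = a ∂/∂p_a.
(The sums over a,b ≥ 1 resp. a ≥ 2 are written with indices shifted to run over all
naturals; `∑ᶠ` denotes the sum of a finitely supported family.) -/
theorem rational_CMS_operator_at_infinity (k : ℂ) (f : Lam) :
    E (Dk k (Dk k (Polynomial.C f))) =
      (∑ᶠ a : ℕ, ∑ᶠ b : ℕ, MvPolynomial.X (a + b) *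
          ((((a+1) : ℕ) : ℂ) • (((b+1) : ℕ) : ℂ) • pderiv (a+1) (pderiv (b+1) f)))
      - k • (∑ᶠ a : ℕ, ∑ᶠ b : ℕ, MvPolynomial.X a * MvPolynomial.X b *
          ((((a+b+2) : ℕ) : ℂ) • pderiv (a+b+2) f))
      + (1 + k) • (∑ᶠ a : ℕ, (((a+1 : ℕ) : ℂ)) •
          (MvPolynomial.X a * ((((a+2) : ℕ) : ℂ) • pderiv (a+2) f))) := by
  obtain ⟨N, hf, hpd⟩ := exists_forall_vars_pderiv_lt f
  have hf0 (i : ℕ) (hi : N ≤ i) : pderiv i f = 0 :=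
    pderiv_eq_zero_of_notMem_vars fun h => (hf i h).not_ge hi
  have hpd0 (l i : ℕ) (hi : N ≤ i) : pderiv i (pderiv l f) = 0 :=
    pderiv_eq_zero_of_notMem_vars fun h => (hpd l i h).not_ge hi
  have h1 : (∑ᶠ a : ℕ, ∑ᶠ b : ℕ, (MvPolynomial.X (a + b) : Lam) *
        ((((a+1) : ℕ) : ℂ) • (((b+1) : ℕ) : ℂ) • pderiv (a+1) (pderiv (b+1) f))) =
      ∑ b ∈ Finset.range (N + 1), ∑ a ∈ Finset.range (N + 1), (MvPolynomial.X (a + b) : Lam) *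
        ((((a+1) : ℕ) : ℂ) • (((b+1) : ℕ) : ℂ) • pderiv (a+1) (pderiv (b+1) f)) := by
    have hb (a : ℕ) := finsum_eq_sum_range (N := N + 1)
      (f := fun b => (MvPolynomial.X (a + b) : Lam) *
        ((((a+1) : ℕ) : ℂ) • (((b+1) : ℕ) : ℂ) • pderiv (a+1) (pderiv (b+1) f)))
      fun b hb => by simp [hf0 (b + 1) (by omega)]
    simp only [hb]
    rw [finsum_eq_sum_range (N := N + 1), Finset.sum_comm]
    intro a ha
    exact Finset.sum_eq_zero fun b _ => by simp [hpd0 (b + 1) (a + 1) (by omega)]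
  have h2 : (∑ᶠ a : ℕ, ∑ᶠ b : ℕ, (MvPolynomial.X a * MvPolynomial.X b : Lam) *
        ((((a+b+2) : ℕ) : ℂ) • pderiv (a+b+2) f)) =
      ∑ n ∈ Finset.range N, ∑ a ∈ Finset.range (n + 1),
        (MvPolynomial.X a * MvPolynomial.X (n - a) : Lam) *
          ((((n+2) : ℕ) : ℂ) • pderiv (n+2) f) := by
    have hb (a : ℕ) := finsum_eq_sum_range (N := N - a)
      (f := fun b => (MvPolynomial.X a * MvPolynomial.X b : Lam) *
        ((((a+b+2) : ℕ) : ℂ) • pderiv (a+b+2) f))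
      fun b hb => by simp [hf0 (a + b + 2) (by omega)]
    simp only [hb]
    rw [finsum_eq_sum_range (N := N), ← Finset.sum_range_diag_flip]
    · refine Finset.sum_congr rfl fun n _ => Finset.sum_congr rfl fun a ha => ?_
      rw [Nat.add_sub_cancel' (Nat.lt_succ_iff.mp (Finset.mem_range.mp ha))]
    · intro a ha
      rw [Nat.sub_eq_zero_of_le ha, Finset.sum_range_zero]
  have h3 : (∑ᶠ a : ℕ, (((a+1 : ℕ) : ℂ)) •
        ((MvPolynomial.X a : Lam) * ((((a+2) : ℕ) : ℂ) • pderiv (a+2) f))) =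
      ∑ a ∈ Finset.range N, (((a+1 : ℕ) : ℂ)) •
        ((MvPolynomial.X a : Lam) * ((((a+2) : ℕ) : ℂ) • pderiv (a+2) f)) :=
    finsum_eq_sum_range fun a ha => by simp [hf0 (a + 2) (by omega)]
  have hE (b : ℕ) : E (coeffDer (((b + 1 : ℕ) : Lam) * pderiv (b + 1) f) * Polynomial.X ^ b) =
      ∑ a ∈ Finset.range (N + 1), (MvPolynomial.X (a + b) : Lam) *
        ((((a+1) : ℕ) : ℂ) • (((b+1) : ℕ) : ℂ) • pderiv (a+1) (pderiv (b+1) f)) := by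
    rw [← nsmul_eq_mul, map_nsmul, nsmul_eq_mul, ← Polynomial.C_eq_natCast, mul_assoc, E_C_mul,
      E_coeffDer_mul_X_pow (N := N + 1) fun i hi => (hpd _ i hi).trans (by omega), Finset.mul_sum]
    refine Finset.sum_congr rfl fun a _ => ?_
    simp only [Nat.cast_smul_eq_nsmul, nsmul_eq_mul]
    ring
  rw [h1, h2, h3, add_smul, one_smul, Dk_C, coeffDer_eq_sum (N := N + 1) fun i hi => (hf i hi).trans (by omega),
    Dk_sum, E_sum]
  simp only [E_Dk_C_mul_X_pow, hE, Finset.sum_sub_distrib, Finset.sum_add_distrib]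
  rw [Finset.sum_range_succ' (fun l => _ * (l : Lam) * _),
    Finset.sum_range_succ' (fun l => k • (_ * E (Dvals l)))]
  simp only [E_Dvals_zero, E_Dvals_succ, mul_sub, smul_sub, Finset.sum_sub_distrib,
    Finset.smul_sum, Finset.mul_sum, Nat.cast_smul_eq_nsmul, nsmul_eq_mul,
    Nat.cast_zero, mul_zero, zero_mul, smul_zero, add_zero, Nat.add_sub_cancel]
  have e1 : ∑ n ∈ Finset.range N, ((n + 1 + 1 : ℕ) : Lam) * pderiv (n + 1 + 1) f *
        ((n + 1 : ℕ) : Lam) * MvPolynomial.X n =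
      ∑ n ∈ Finset.range N, ((n + 1 : ℕ) : Lam) *
        (MvPolynomial.X n * (((n + 2 : ℕ) : Lam) * pderiv (n + 2) f)) :=
    Finset.sum_congr rfl fun n _ => by ring
  have e2 : ∑ n ∈ Finset.range N, k • (((n + 1 + 1 : ℕ) : Lam) * pderiv (n + 1 + 1) f *
        (((n + 1 : ℕ) : Lam) * MvPolynomial.X n)) =
      ∑ n ∈ Finset.range N, k • (((n + 1 : ℕ) : Lam) *
        (MvPolynomial.X n * (((n + 2 : ℕ) : Lam) * pderiv (n + 2) f))) :=
    Finset.sum_congr rfl fun n _ => by congr 1; ring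
  have e3 : ∑ n ∈ Finset.range N, ∑ j ∈ Finset.range (n + 1),
        k • (((n + 1 + 1 : ℕ) : Lam) * pderiv (n + 1 + 1) f *
          (MvPolynomial.X j * MvPolynomial.X (n - j))) =
      ∑ n ∈ Finset.range N, ∑ j ∈ Finset.range (n + 1),
        k • (MvPolynomial.X j * MvPolynomial.X (n - j) *
          (((n + 2 : ℕ) : Lam) * pderiv (n + 2) f)) :=
    Finset.sum_congr rfl fun n _ => Finset.sum_congr rfl fun j _ => by congr 1; ring
  rw [e1, e2, e3]
  abel
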